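/- Let d ≥ 1 and 1 ≤ i_1 ≤ d be integers. There exists a lattice polytope P ⊂ ℝ^d of dimension d whose δ-polynomial equals 1 + t^{i_1} if and only if i_1 ≤ ⌊(d+1)/2⌋. -/

import Mathlib

open Pointwise Polynomial

noncomputable section

/-- The set of lattice points of `ℝ^d` (points with integer coordinates). -/
def latticePts (d : ℕ) : Set (Fin d → ℝ) := {x | ∀ i, ∃ z : ℤ, x i = (z : ℝ)}

/-- A lattice polytope: the convex hull of finitely many lattice points. -/
def IsLatticePolytope {d : ℕ} (P : Set (Fin d → ℝ)) : Prop :=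
  ∃ V : Finset (Fin d → ℝ), (V : Set (Fin d → ℝ)) ⊆ latticePts d ∧
    P = convexHull ℝ (V : Set (Fin d → ℝ))

/-- `|nP ∩ ℤ^d|`. -/
def ehrhartCount {d : ℕ} (P : Set (Fin d → ℝ)) (n : ℕ) : ℕ :=
  (latticePts d ∩ (n : ℝ) • P).ncard

/-- The Ehrhart series `1 + Σ_{n ≥ 1} |nP ∩ ℤ^d| tⁿ`. -/
def ehrhartSeries {d : ℕ} (P : Set (Fin d → ℝ)) : PowerSeries ℤ :=
  PowerSeries.mk fun n => if n = 0 then 1 else (ehrhartCount P n : ℤ)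

/-- `p` is the δ-polynomial of the lattice polytope `P ⊆ ℝ^d` of dimension `d`,
i.e. `(1 - t)^(d+1) (1 + Σ_{n ≥ 1} |nP ∩ ℤ^d| tⁿ) = p`. -/
def HasDeltaPoly {d : ℕ} (P : Set (Fin d → ℝ)) (p : Polynomial ℤ) : Prop :=
  (1 - PowerSeries.X) ^ (d + 1) * ehrhartSeries P = (p : PowerSeries ℤ)

/-- Unimodular equivalence: an affine map carrying `ℤ^d ∩ aff P` bijectively onto
`ℤ^e ∩ aff Q` and mapping `P` onto `Q`. -/
def UnimodEquiv {d e : ℕ} (P : Set (Fin d → ℝ)) (Q : Set (Fin e → ℝ)) : Prop :=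
  ∃ f : (Fin d → ℝ) →ᵃ[ℝ] (Fin e → ℝ),
    Set.BijOn f (latticePts d ∩ (affineSpan ℝ P : Set (Fin d → ℝ)))
      (latticePts e ∩ (affineSpan ℝ Q : Set (Fin e → ℝ))) ∧ f '' P = Q

/-- The lattice pyramid `Pyr(Q) = conv(Q × {0}, (0,…,0,1)) ⊆ ℝ^{e+1}`. -/
def pyramidOver {e : ℕ} (Q : Set (Fin e → ℝ)) : Set (Fin (e + 1) → ℝ) :=
  convexHull ℝ
    ((fun x : Fin e → ℝ => Fin.snoc x (0 : ℝ)) '' Q ∪ {Fin.snoc (0 : Fin e → ℝ) (1 : ℝ)})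

/-- `P` is a lattice pyramid over some (full-dimensional) lattice polytope. -/
def IsLatticePyramid {d : ℕ} (P : Set (Fin d → ℝ)) : Prop :=
  ∃ (e : ℕ) (Q : Set (Fin e → ℝ)), IsLatticePolytope Q ∧ affineSpan ℝ Q = ⊤ ∧
    UnimodEquiv P (pyramidOver Q)

/-- `P ⊆ ℝ^d` is a simplex (of some dimension). -/
def IsSimplex {d : ℕ} (P : Set (Fin d → ℝ)) : Prop :=
  ∃ (n : ℕ) (v : Fin (n + 1) → Fin d → ℝ), AffineIndependent ℝ v ∧
    P = convexHull ℝ (Set.range v)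

/-- A full-dimensional lattice simplex of dimension `d` in `ℝ^d`. -/
def IsLatticeSimplexFD {d : ℕ} (Δ : Set (Fin d → ℝ)) : Prop :=
  ∃ v : Fin (d + 1) → Fin d → ℝ, AffineIndependent ℝ v ∧
    (∀ i, v i ∈ latticePts d) ∧ Δ = convexHull ℝ (Set.range v)

/-- `ℤ((P,1) ∩ ℤ^{d+1}) = ℤ^{d+1}`: the lattice points of `P`, with last coordinate `1`
appended, generate all of `ℤ^{d+1}` as a group. -/
def SpansLattice {d : ℕ} (P : Set (Fin d → ℝ)) : Prop :=
  AddSubgroup.closure {y : Fin (d + 1) → ℤ |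
    y (Fin.last d) = 1 ∧ (fun i : Fin d => (y i.castSucc : ℝ)) ∈ P} = ⊤

/-- The finite abelian group `Λ_Δ ⊆ (ℝ/ℤ)^{d+1}` attached to a lattice simplex with
ordered vertices `v 0, …, v d`, encoded by its canonical representatives in `[0,1)`. -/
def simplexLambda {d : ℕ} (v : Fin (d + 1) → Fin d → ℝ) : Set (Fin (d + 1) → ℝ) :=
  {c | (∀ i, 0 ≤ c i ∧ c i < 1) ∧
    (∀ j : Fin d, ∃ z : ℤ, (∑ i, c i * v i j) = (z : ℝ)) ∧
    (∃ z : ℤ, (∑ i, c i) = (z : ℝ))}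

/-- The standard basis vector `e_j` of `ℝ^d` (0-indexed). -/
def stdE (d : ℕ) (j : Fin d) : Fin d → ℝ := fun i => if i = j then 1 else 0

/-- Nonnegative coefficient vectors of total weight `n` whose combination of the points `v i`
is a lattice point. -/
def latticeCombos {d : ℕ} (v : Fin (d + 1) → Fin d → ℝ) (n : ℕ) : Set (Fin (d + 1) → ℝ) :=
  {c | (∀ i, 0 ≤ c i) ∧ ∑ i, c i = n ∧ ∑ i, c i • v i ∈ latticePts d}

theorem mem_convexHull_range_iff {d m : ℕ} (v : Fin m → Fin d → ℝ) (x : Fin d → ℝ) :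
    x ∈ convexHull ℝ (Set.range v) ↔
      ∃ c : Fin m → ℝ, (∀ i, 0 ≤ c i) ∧ ∑ i, c i = 1 ∧ ∑ i, c i • v i = x := by
  constructor
  · rw [convexHull_range_eq_exists_affineCombination]
    rintro ⟨s, w, hw, hw1, rfl⟩
    refine ⟨fun i => if i ∈ s then w i else 0, fun i => ?_, ?_, ?_⟩
    · dsimp only
      split_ifs with h
      exacts [hw i h, le_rfl]
    · simpa using hw1
    · rw [s.affineCombination_eq_linear_combination v w hw1]
      simp [ite_smul]
  · rintro ⟨c, hc, hc1, hx⟩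
    exact mem_convexHull_of_exists_fintype c v hc hc1 (fun i => ⟨i, rfl⟩) hx

theorem mem_smul_convexHull_range_iff {d m : ℕ} (v : Fin m → Fin d → ℝ) {n : ℕ} (hn : 1 ≤ n)
    (x : Fin d → ℝ) :
    x ∈ (n : ℝ) • convexHull ℝ (Set.range v) ↔
      ∃ c : Fin m → ℝ, (∀ i, 0 ≤ c i) ∧ ∑ i, c i = n ∧ ∑ i, c i • v i = x := by
  have hn0 : (n : ℝ) ≠ 0 := by positivity
  rw [Set.mem_smul_set]
  constructor
  · rintro ⟨y, hy, rfl⟩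
    obtain ⟨c, hc, hc1, rfl⟩ := (mem_convexHull_range_iff v y).1 hy
    refine ⟨fun i => n * c i, fun i => mul_nonneg (by positivity) (hc i), ?_, ?_⟩
    · rw [← Finset.mul_sum, hc1, mul_one]
    · simp_rw [mul_smul, Finset.smul_sum]
  · rintro ⟨c, hc, hc1, rfl⟩
    refine ⟨∑ i, ((n : ℝ)⁻¹ * c i) • v i, (mem_convexHull_range_iff v _).2
      ⟨_, fun i => mul_nonneg (by positivity) (hc i), ?_, rfl⟩, ?_⟩
    · rw [← Finset.mul_sum, hc1, inv_mul_cancel₀ hn0]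
    · simp_rw [mul_smul, ← Finset.smul_sum, smul_inv_smul₀ hn0]

theorem ehrhartCount_simplex {d : ℕ} {v : Fin (d + 1) → Fin d → ℝ} (hv : AffineIndependent ℝ v)
    {n : ℕ} (hn : 1 ≤ n) :
    ehrhartCount (convexHull ℝ (Set.range v)) n = (latticeCombos v n).ncard := by
  have himage : latticePts d ∩ (n : ℝ) • convexHull ℝ (Set.range v) =
      (fun c : Fin (d + 1) → ℝ => ∑ i, c i • v i) '' latticeCombos v n := by
    ext x
    rw [Set.mem_inter_iff, mem_smul_convexHull_range_iff v hn]
    constructor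
    · rintro ⟨hx, c, hc, hcn, rfl⟩
      exact ⟨c, ⟨hc, hcn, hx⟩, rfl⟩
    · rintro ⟨c, ⟨hc, hcn, hx⟩, rfl⟩
      exact ⟨hx, c, hc, hcn, rfl⟩
  rw [ehrhartCount, himage, Set.InjOn.ncard_image]
  rintro c ⟨-, hc, -⟩ c' ⟨-, hc', -⟩ h
  funext i
  refine sub_eq_zero.1 (affineIndependent_iff.1 hv Finset.univ (fun i => c i - c' i) ?_ ?_ i
    (Finset.mem_univ i))
  · rw [Finset.sum_sub_distrib, hc, hc', sub_self]
  · simp_rw [sub_smul]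
    rw [Finset.sum_sub_distrib, sub_eq_zero]
    exact h

theorem hasDeltaPoly_one_add_X_pow_iff {d k : ℕ} (hk : 1 ≤ k) (P : Set (Fin d → ℝ)) :
    HasDeltaPoly P (1 + X ^ k) ↔ ∀ n, 1 ≤ n → ehrhartCount P n =
      (d + n).choose d + if k ≤ n then (d + (n - k)).choose d else 0 := by
  have hinv : (1 - PowerSeries.X : PowerSeries ℤ) ^ (d + 1) *
      (PowerSeries.invOneSubPow ℤ (d + 1)).val = 1 := (PowerSeries.invOneSubPow ℤ (d + 1)).inv_val
  have hser : HasDeltaPoly P (1 + X ^ k) ↔ ehrhartSeries P =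
      (PowerSeries.invOneSubPow ℤ (d + 1)).val +
        (PowerSeries.invOneSubPow ℤ (d + 1)).val * PowerSeries.X ^ k := by
    simp only [HasDeltaPoly, Polynomial.coe_add, Polynomial.coe_one, Polynomial.coe_pow,
      Polynomial.coe_X]
    constructor
    · intro h
      linear_combination (PowerSeries.invOneSubPow ℤ (d + 1)).val * h - ehrhartSeries P * hinv
    · intro h
      rw [h]
      linear_combination (1 + PowerSeries.X ^ k) * hinv
  rw [hser, PowerSeries.ext_iff, PowerSeries.invOneSubPow_val_succ_eq_mk_add_choose]
  simp only [map_add, PowerSeries.coeff_mul_X_pow', PowerSeries.coeff_mk, ehrhartSeries]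
  refine forall_congr' fun n => ?_
  rcases Nat.eq_zero_or_pos n with rfl | hn
  · simp [show ¬ k ≤ 0 by omega]
  · rw [if_neg hn.ne']
    simp only [show 1 ≤ n from hn, true_imp_iff]
    split_ifs <;> norm_cast

theorem card_piAntidiag_univ_fin (d n : ℕ) :
    (Finset.piAntidiag (Finset.univ : Finset (Fin (d + 1))) n).card = (d + n).choose d := by
  rw [← Finset.map_sym_eq_piAntidiag, Finset.card_map, Finset.sym_univ, Finset.card_univ,
    Sym.card_sym_eq_choose, Fintype.card_fin, Nat.add_right_comm, Nat.add_sub_cancel,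
    Nat.choose_symm_add]

/-- The coefficient vectors obtained by adding natural numbers of total `n` to `h`. -/
def natTranslates {d : ℕ} (h : Fin (d + 1) → ℝ) (n : ℕ) : Set (Fin (d + 1) → ℝ) :=
  (fun (a : Fin (d + 1) → ℕ) i => h i + a i) '' {a | ∑ i, a i = n}

theorem coe_piAntidiag_univ (d n : ℕ) : {a : Fin (d + 1) → ℕ | ∑ i, a i = n} =
    (Finset.piAntidiag (Finset.univ : Finset (Fin (d + 1))) n : Set (Fin (d + 1) → ℕ)) := by
  ext a
  simp

theorem natTranslates_finite {d : ℕ} (h : Fin (d + 1) → ℝ) (n : ℕ) :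
    (natTranslates h n).Finite := by
  rw [natTranslates, coe_piAntidiag_univ]
  exact (Finset.finite_toSet _).image _

theorem ncard_natTranslates {d : ℕ} (h : Fin (d + 1) → ℝ) (n : ℕ) :
    (natTranslates h n).ncard = (d + n).choose d := by
  rw [natTranslates, coe_piAntidiag_univ, Set.ncard_image_of_injective, Set.ncard_coe_finset,
    card_piAntidiag_univ_fin]
  intro a b hab
  funext i
  simpa using congrFun hab i

theorem mem_natTranslates_iff {d : ℕ} {h c : Fin (d + 1) → ℝ} (hh : ∀ i, h i < 1)
    (hc : ∀ i, 0 ≤ c i) {n : ℕ} (hsum : ∑ i, c i = ∑ i, h i + n) :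
    c ∈ natTranslates h n ↔ ∀ i, ∃ z : ℤ, c i = h i + z := by
  constructor
  · rintro ⟨a, -, rfl⟩ i
    exact ⟨a i, by simp⟩
  · intro hz
    choose z hz using hz
    have hz0 : ∀ i, 0 ≤ z i := fun i => by
      have h1 := hc i
      rw [hz i] at h1
      have h2 : (-1 : ℝ) < z i := by linarith [hh i]
      have h3 : (-1 : ℤ) < z i := by exact_mod_cast h2
      omega
    lift z to Fin (d + 1) → ℕ using hz0
    refine ⟨z, ?_, funext fun i => (by rw [hz i]; simp)⟩
    simp_rw [hz, Finset.sum_add_distrib] at hsum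
    have := add_left_cancel hsum
    exact_mod_cast this

theorem sum_intCast_smul_mem_latticePts {d m : ℕ} {v : Fin m → Fin d → ℝ}
    (hv : ∀ i, v i ∈ latticePts d) (z : Fin m → ℤ) : ∑ i, (z i : ℝ) • v i ∈ latticePts d := by
  intro j
  choose w hw using fun i => hv i j
  exact ⟨∑ i, z i * w i, by simp [Finset.sum_apply, hw]⟩

theorem add_mem_latticePts {d : ℕ} {x y : Fin d → ℝ} (hx : x ∈ latticePts d)
    (hy : y ∈ latticePts d) : x + y ∈ latticePts d := fun i => by
  obtain ⟨a, ha⟩ := hx i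
  obtain ⟨b, hb⟩ := hy i
  exact ⟨a + b, by simp [ha, hb]⟩

theorem neg_mem_latticePts {d : ℕ} {x : Fin d → ℝ} (hx : x ∈ latticePts d) :
    -x ∈ latticePts d := fun i => by
  obtain ⟨a, ha⟩ := hx i
  exact ⟨-a, by simp [ha]⟩

theorem natTranslates_zero_subset {d : ℕ} {v : Fin (d + 1) → Fin d → ℝ}
    (hv : ∀ i, v i ∈ latticePts d) (n : ℕ) : natTranslates 0 n ⊆ latticeCombos v n := by
  rintro _ ⟨a, ha, rfl⟩
  refine ⟨fun i => by simp, ?_, ?_⟩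
  · simp only [Pi.zero_apply, zero_add]
    exact_mod_cast ha
  · simpa using sum_intCast_smul_mem_latticePts hv fun i => (a i : ℤ)

theorem fract_mem_latticeCombos {d : ℕ} {v : Fin (d + 1) → Fin d → ℝ}
    (hv : ∀ i, v i ∈ latticePts d) {c : Fin (d + 1) → ℝ} {m : ℤ} (hm : ∑ i, c i = m)
    (hc : ∑ i, c i • v i ∈ latticePts d) :
    ∃ n : ℕ, (fun i => Int.fract (c i)) ∈ latticeCombos v n := by
  have hsum : ∑ i, Int.fract (c i) = ((m - ∑ i, ⌊c i⌋ : ℤ) : ℝ) := by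
    simp_rw [Int.fract]
    rw [Finset.sum_sub_distrib, hm]
    push_cast
    rfl
  have hnonneg : 0 ≤ m - ∑ i, ⌊c i⌋ := by
    have : (0 : ℝ) ≤ ∑ i, Int.fract (c i) := Finset.sum_nonneg fun i _ => Int.fract_nonneg _
    rw [hsum] at this
    exact_mod_cast this
  obtain ⟨n, hn⟩ := Int.eq_ofNat_of_zero_le hnonneg
  refine ⟨n, fun i => Int.fract_nonneg _, ?_, ?_⟩
  · rw [hsum, hn]
    simp
  · have heq : ∑ i, Int.fract (c i) • v i =
        ∑ i, c i • v i + -∑ i, ((⌊c i⌋ : ℤ) : ℝ) • v i := by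
      simp_rw [Int.fract, sub_smul]
      rw [Finset.sum_sub_distrib, sub_eq_add_neg]
    rw [heq]
    exact add_mem_latticePts hc (neg_mem_latticePts (sum_intCast_smul_mem_latticePts hv _))

theorem two_mul_le_of_ehrhartCount_simplex {d k : ℕ} {v : Fin (d + 1) → Fin d → ℝ}
    (hk : 1 ≤ k) (hv : ∀ i, v i ∈ latticePts d) (hind : AffineIndependent ℝ v)
    (hlt : ∀ n, 1 ≤ n → n < k →
      ehrhartCount (convexHull ℝ (Set.range v)) n = (d + n).choose d)
    (heq : (d + k).choose d < ehrhartCount (convexHull ℝ (Set.range v)) k) :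
    2 * k ≤ d + 1 := by
  have hmin : ∀ n < k, ∀ c ∈ latticeCombos v n, ∀ i, ∃ z : ℤ, c i = z := by
    intro n hn c hc
    rcases Nat.eq_zero_or_pos n with rfl | hn0
    · have hzero := (Finset.sum_eq_zero_iff_of_nonneg fun i _ => hc.1 i).1
        (hc.2.1.trans Nat.cast_zero)
      exact fun i => ⟨0, by simpa using hzero i (Finset.mem_univ i)⟩
    · have hcard := hlt n hn0 hn
      rw [ehrhartCount_simplex hind hn0] at hcard
      have hfin : (latticeCombos v n).Finite := Set.finite_of_ncard_pos <| by
        rw [hcard]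
        exact Nat.choose_pos (Nat.le_add_right d n)
      have hset := Set.eq_of_subset_of_ncard_le (natTranslates_zero_subset hv n)
        (by rw [hcard, ncard_natTranslates]) hfin
      rw [← hset] at hc
      obtain ⟨a, -, rfl⟩ := hc
      exact fun i => ⟨a i, by simp⟩
  rw [ehrhartCount_simplex hind hk, ← ncard_natTranslates 0 k] at heq
  obtain ⟨c, hc, hcn⟩ := Set.exists_mem_notMem_of_ncard_lt_ncard heq (natTranslates_finite 0 k)
  have hnonint : ¬ ∀ i, ∃ z : ℤ, c i = z := by
    rw [mem_natTranslates_iff (by simp) hc.1 (by simpa using hc.2.1)] at hcn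
    simpa using hcn
  obtain ⟨n₁, h₁⟩ := fract_mem_latticeCombos (m := k) hv (by simpa using hc.2.1) hc.2.2
  obtain ⟨n₂, h₂⟩ := fract_mem_latticeCombos (c := fun i => -c i) (m := -k) hv
    (by simpa using hc.2.1) (by simpa using neg_mem_latticePts hc.2.2)
  have hk₁ : k ≤ n₁ := by
    by_contra! hlt₁
    refine hnonint fun i => ?_
    obtain ⟨z, hz⟩ := hmin n₁ hlt₁ _ h₁ i
    exact ⟨⌊c i⌋ + z, by push_cast; rw [← hz, Int.floor_add_fract]⟩
  have hk₂ : k ≤ n₂ := by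
    by_contra! hlt₂
    refine hnonint fun i => ?_
    obtain ⟨z, hz⟩ := hmin n₂ hlt₂ _ h₂ i
    exact ⟨-(⌊-c i⌋ + z), by push_cast; rw [← hz, Int.floor_add_fract, neg_neg]⟩
  have hle : ∑ i, (Int.fract (c i) + Int.fract (-c i)) ≤ ∑ _i : Fin (d + 1), (1 : ℝ) := by
    refine Finset.sum_le_sum fun i _ => ?_
    by_cases h : Int.fract (c i) = 0
    · rw [h, Int.fract_neg_eq_zero.2 h]
      norm_num
    · rw [Int.fract_neg h]
      linarith
  rw [Finset.sum_add_distrib, h₁.2.1, h₂.2.1] at hle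
  simp only [Finset.sum_const, Finset.card_univ, Fintype.card_fin, nsmul_eq_mul, mul_one] at hle
  have : n₁ + n₂ ≤ d + 1 := by exact_mod_cast hle
  omega

theorem succ_le_card_of_affineSpan_eq_top {d : ℕ} {V : Finset (Fin d → ℝ)}
    (hV : affineSpan ℝ (V : Set (Fin d → ℝ)) = ⊤) : d + 1 ≤ V.card := by
  have hne : V.Nonempty := by
    rw [← Finset.coe_nonempty, ← affineSpan_nonempty (k := ℝ), hV]
    exact ⟨0, trivial⟩
  have hcard := finrank_vectorSpan_range_le ℝ ((↑) : V → Fin d → ℝ) (n := V.card - 1) (by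
    have := hne.card_pos
    rw [Fintype.card_coe]
    omega)
  rw [Subtype.range_coe_subtype, Finset.setOfPred_mem, ← direction_affineSpan, hV,
    AffineSubspace.direction_top, finrank_top, Module.finrank_fin_fun] at hcard
  have := hne.card_pos
  omega

theorem exists_simplex_of_ehrhartCount_one {d : ℕ} {P : Set (Fin d → ℝ)}
    (hP : IsLatticePolytope P) (htop : affineSpan ℝ P = ⊤) (hcount : ehrhartCount P 1 = d + 1) :
    ∃ v : Fin (d + 1) → Fin d → ℝ, AffineIndependent ℝ v ∧ (∀ i, v i ∈ latticePts d) ∧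
      P = convexHull ℝ (Set.range v) := by
  obtain ⟨V, hV, rfl⟩ := hP
  rw [affineSpan_convexHull] at htop
  rw [ehrhartCount, Nat.cast_one, one_smul] at hcount
  have hle : V.card ≤ d + 1 := by
    rw [← hcount, ← Set.ncard_coe_finset]
    refine Set.ncard_le_ncard (Set.subset_inter hV (subset_convexHull ℝ _)) ?_
    exact Set.finite_of_ncard_pos (by omega)
  have hcard : V.card = d + 1 := le_antisymm hle (succ_le_card_of_affineSpan_eq_top htop)
  let e := V.equivFinOfCardEq hcard
  have hrange : Set.range (fun i => (e.symm i : Fin d → ℝ)) = V := by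
    ext x
    constructor
    · rintro ⟨i, rfl⟩
      exact (e.symm i).2
    · exact fun hx => ⟨e ⟨x, hx⟩, by simp⟩
  refine ⟨fun i => e.symm i, ?_, fun i => hV (e.symm i).2, by rw [hrange]⟩
  rw [affineIndependent_iff_finrank_vectorSpan_eq ℝ _ (n := d) (by simp), hrange,
    ← direction_affineSpan, htop, AffineSubspace.direction_top, finrank_top,
    Module.finrank_fin_fun]

/-- The vertices of a lattice simplex of normalized volume two: the origin, `e_1, …, e_e` and
`e_1 + ⋯ + e_{2k-2} + 2 e_{e+1}`. -/
def volTwoVertex (e k : ℕ) (i : Fin (e + 2)) (j : Fin (e + 1)) : ℝ :=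
  if i = Fin.last (e + 1) then
    if j = Fin.last e then 2 else if (j : ℕ) + 1 < 2 * k - 1 then 1 else 0
  else if i = j.succ then 1 else 0

/-- The coefficients of the half-integral point of the simplex `volTwoVertex e k`. -/
def halfCoeff (e k : ℕ) (i : Fin (e + 2)) : ℝ :=
  if i = Fin.last (e + 1) ∨ (i : ℕ) < 2 * k - 1 then 1 / 2 else 0

theorem sum_smul_volTwoVertex_last (e k : ℕ) (c : Fin (e + 2) → ℝ) :
    (∑ i, c i • volTwoVertex e k i) (Fin.last e) = 2 * c (Fin.last (e + 1)) := by
  rw [Finset.sum_apply, Fin.sum_univ_castSucc]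
  simp [volTwoVertex, Fin.castSucc_ne_last, mul_comm]

theorem sum_smul_volTwoVertex_castSucc (e k : ℕ) (c : Fin (e + 2) → ℝ) (j : Fin e) :
    (∑ i, c i • volTwoVertex e k i) j.castSucc = c j.castSucc.succ +
      if (j : ℕ) + 1 < 2 * k - 1 then c (Fin.last (e + 1)) else 0 := by
  rw [Finset.sum_apply, Fin.sum_univ_castSucc]
  simp [volTwoVertex, Fin.castSucc_ne_last, ← Fin.castSucc_succ]

theorem volTwoVertex_mem_latticePts (e k : ℕ) (i : Fin (e + 2)) :
    volTwoVertex e k i ∈ latticePts (e + 1) := by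
  intro j
  unfold volTwoVertex
  split_ifs
  exacts [⟨2, by simp⟩, ⟨1, by simp⟩, ⟨0, by simp⟩, ⟨1, by simp⟩, ⟨0, by simp⟩]

theorem forall_of_forall_succ_of_sum {m : ℕ} {c h : Fin (m + 1) → ℝ} {s : ℤ}
    (hs : ∑ i, c i = ∑ i, h i + s) (hsucc : ∀ i : Fin m, ∃ z : ℤ, c i.succ = h i.succ + z)
    (i : Fin (m + 1)) : ∃ z : ℤ, c i = h i + z := by
  choose z hz using hsucc
  refine Fin.cases ⟨s - ∑ i, z i, ?_⟩ (fun i => ⟨z i, hz i⟩) i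
  rw [Fin.sum_univ_succ, Fin.sum_univ_succ] at hs
  simp_rw [hz, Finset.sum_add_distrib] at hs
  push_cast
  linarith

theorem affineIndependent_volTwoVertex (e k : ℕ) : AffineIndependent ℝ (volTwoVertex e k) := by
  rw [affineIndependent_iff_of_fintype]
  intro w hw hsum
  rw [Finset.weightedVSub_eq_linear_combination _ hw] at hsum
  have hlast : w (Fin.last (e + 1)) = 0 := by
    have h := sum_smul_volTwoVertex_last e k w
    rw [hsum] at h
    simpa using h
  have hsucc : ∀ i : Fin (e + 1), w i.succ = 0 := by
    refine Fin.lastCases hlast fun j => ?_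
    have h := sum_smul_volTwoVertex_castSucc e k w j
    rw [hsum, hlast] at h
    simpa using h.symm
  refine Fin.cases ?_ hsucc
  rw [Fin.sum_univ_succ] at hw
  simpa [hsucc] using hw

theorem sum_halfCoeff {e k : ℕ} (hk : 1 ≤ k) (hke : 2 * k ≤ e + 2) :
    ∑ i, halfCoeff e k i = k := by
  have hcast : ((2 * k - 1 : ℕ) : ℝ) = 2 * k - 1 := by
    rw [Nat.cast_sub (by omega)]
    push_cast
    ring
  rw [Fin.sum_univ_castSucc]
  simp only [halfCoeff, Fin.castSucc_ne_last, false_or, true_or, if_true, Fin.val_castSucc]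
  rw [← Finset.sum_filter, Finset.sum_const, Fin.card_filter_val_lt, min_eq_right (by omega),
    nsmul_eq_mul, hcast]
  ring

theorem halfCoeff_mem_latticeCombos {e k : ℕ} (hk : 1 ≤ k) (hke : 2 * k ≤ e + 2) :
    halfCoeff e k ∈ latticeCombos (volTwoVertex e k) k := by
  refine ⟨fun i => ?_, sum_halfCoeff hk hke, ?_⟩
  · unfold halfCoeff
    split_ifs <;> norm_num
  · refine Fin.lastCases ⟨1, ?_⟩ fun j => ?_
    · rw [sum_smul_volTwoVertex_last]
      simp [halfCoeff]
    · rw [sum_smul_volTwoVertex_castSucc]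
      have hne : j.castSucc.succ ≠ Fin.last (e + 1) := by
        rw [Fin.succ_castSucc]
        exact Fin.castSucc_ne_last _
      by_cases hj : (j : ℕ) + 1 < 2 * k - 1
      · exact ⟨1, by simp [halfCoeff, hj]; norm_num⟩
      · exact ⟨0, by simp [halfCoeff, hj, hne]⟩

theorem integral_or_half_of_mem_latticeCombos {e k n : ℕ} (hk : 1 ≤ k) (hke : 2 * k ≤ e + 2)
    {c : Fin (e + 2) → ℝ} (hc : c ∈ latticeCombos (volTwoVertex e k) n) :
    (∀ i, ∃ z : ℤ, c i = (0 : Fin (e + 2) → ℝ) i + z) ∨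
      ∀ i, ∃ z : ℤ, c i = halfCoeff e k i + z := by
  obtain ⟨z, hz⟩ := hc.2.2 (Fin.last e)
  rw [sum_smul_volTwoVertex_last] at hz
  choose w hw using fun j : Fin e => hc.2.2 j.castSucc
  simp_rw [sum_smul_volTwoVertex_castSucc] at hw
  rcases Int.even_or_odd' z with ⟨m, rfl | rfl⟩
  · have hlast : c (Fin.last (e + 1)) = m := by
      push_cast at hz
      linarith
    refine Or.inl (forall_of_forall_succ_of_sum (s := n) (by simpa using hc.2.1) ?_)
    refine Fin.lastCases ⟨m, by simpa using hlast⟩ fun j => ?_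
    have hj := hw j
    rw [hlast] at hj
    split_ifs at hj
    · exact ⟨w j - m, by push_cast; rw [Pi.zero_apply]; linarith⟩
    · exact ⟨w j, by rw [Pi.zero_apply]; linarith⟩
  · have hlast : c (Fin.last (e + 1)) = 1 / 2 + m := by
      push_cast at hz
      linarith
    refine Or.inr (forall_of_forall_succ_of_sum (s := n - k) ?_ ?_)
    · rw [hc.2.1, sum_halfCoeff hk hke]
      push_cast
      ring
    refine Fin.lastCases ⟨m, by simpa [halfCoeff] using hlast⟩ fun j => ?_
    have hne : j.castSucc.succ ≠ Fin.last (e + 1) := by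
      rw [Fin.succ_castSucc]
      exact Fin.castSucc_ne_last _
    have hj := hw j
    rw [hlast] at hj
    by_cases hjk : (j : ℕ) + 1 < 2 * k - 1
    · rw [if_pos hjk] at hj
      refine ⟨w j - m - 1, ?_⟩
      have : halfCoeff e k j.castSucc.succ = 1 / 2 := by simp [halfCoeff, hjk]
      rw [this]
      push_cast
      linarith
    · rw [if_neg hjk] at hj
      refine ⟨w j, ?_⟩
      have : halfCoeff e k j.castSucc.succ = 0 := by simp [halfCoeff, hjk, hne]
      rw [this]
      linarith

theorem natTranslates_halfCoeff_subset {e k n : ℕ} (hk : 1 ≤ k) (hke : 2 * k ≤ e + 2)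
    (hkn : k ≤ n) :
    natTranslates (halfCoeff e k) (n - k) ⊆ latticeCombos (volTwoVertex e k) n := by
  rintro _ ⟨a, ha, rfl⟩
  have hhalf := halfCoeff_mem_latticeCombos hk hke
  refine ⟨fun i => add_nonneg (hhalf.1 i) (by positivity), ?_, ?_⟩
  · rw [Finset.sum_add_distrib, hhalf.2.1, ← Nat.cast_sum, show ∑ i, a i = n - k from ha,
      Nat.cast_sub hkn]
    ring
  · simp_rw [add_smul, Finset.sum_add_distrib]
    refine add_mem_latticePts hhalf.2.2 ?_
    simpa using sum_intCast_smul_mem_latticePts (volTwoVertex_mem_latticePts e k)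
      fun i => (a i : ℤ)

theorem latticeCombos_volTwoVertex {e k : ℕ} (hk : 1 ≤ k) (hke : 2 * k ≤ e + 2) (n : ℕ) :
    latticeCombos (volTwoVertex e k) n = natTranslates 0 n ∪
      if k ≤ n then natTranslates (halfCoeff e k) (n - k) else ∅ := by
  have hlt : ∀ i, halfCoeff e k i < 1 := fun i => by
    unfold halfCoeff
    split_ifs <;> norm_num
  refine Set.Subset.antisymm (fun c hc => ?_) (Set.union_subset
    (natTranslates_zero_subset (volTwoVertex_mem_latticePts e k) n) ?_)
  · rcases integral_or_half_of_mem_latticeCombos hk hke hc with h | h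
    · exact Or.inl ((mem_natTranslates_iff (by simp) hc.1 (by simpa using hc.2.1)).2 h)
    · have hle : k ≤ n := by
        have : ∑ i, halfCoeff e k i ≤ ∑ i, c i := by
          refine Finset.sum_le_sum fun i _ => ?_
          obtain ⟨z, hz⟩ := h i
          have h1 : (-1 : ℝ) < z := by linarith [hlt i, hc.1 i]
          have h2 : (-1 : ℤ) < z := by exact_mod_cast h1
          have h3 : (0 : ℝ) ≤ z := by exact_mod_cast (by omega : 0 ≤ z)
          linarith
        rw [sum_halfCoeff hk hke, hc.2.1] at this
        exact_mod_cast this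
      rw [if_pos hle]
      refine Or.inr ((mem_natTranslates_iff hlt hc.1 ?_).2 h)
      rw [hc.2.1, sum_halfCoeff hk hke, Nat.cast_sub hle]
      ring
  · split_ifs with h
    exacts [natTranslates_halfCoeff_subset hk hke h, Set.empty_subset _]

theorem disjoint_natTranslates_halfCoeff (e k m n : ℕ) :
    Disjoint (natTranslates (0 : Fin (e + 2) → ℝ) m) (natTranslates (halfCoeff e k) n) := by
  rw [Set.disjoint_left]
  rintro _ ⟨a, -, rfl⟩ ⟨b, -, hab⟩
  have h := congrFun hab (Fin.last (e + 1))
  simp only [halfCoeff, true_or, if_true, Pi.zero_apply, zero_add] at h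
  have h2 : 1 + 2 * (b (Fin.last (e + 1)) : ℝ) = 2 * a (Fin.last (e + 1)) := by linarith
  have h3 : 1 + 2 * b (Fin.last (e + 1)) = 2 * a (Fin.last (e + 1)) := by exact_mod_cast h2
  omega

theorem hasDeltaPoly_volTwoVertex {e k : ℕ} (hk : 1 ≤ k) (hke : 2 * k ≤ e + 2) :
    HasDeltaPoly (convexHull ℝ (Set.range (volTwoVertex e k))) (1 + X ^ k) := by
  rw [hasDeltaPoly_one_add_X_pow_iff hk]
  intro n hn
  rw [ehrhartCount_simplex (affineIndependent_volTwoVertex e k) hn,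
    latticeCombos_volTwoVertex hk hke]
  split_ifs
  · rw [Set.ncard_union_eq (disjoint_natTranslates_halfCoeff e k _ _) (natTranslates_finite _ _)
      (natTranslates_finite _ _), ncard_natTranslates, ncard_natTranslates]
  · rw [Set.union_empty, ncard_natTranslates, add_zero]

/-- possible δ-polynomials `1 + t^{i₁}` (normalized volume 2). -/
theorem delta_poly_volume_two (d i1 : ℕ) (hd : 1 ≤ d) (hi1 : 1 ≤ i1) (hi1d : i1 ≤ d) :
    (∃ P : Set (Fin d → ℝ), IsLatticePolytope P ∧ affineSpan ℝ P = ⊤ ∧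
      HasDeltaPoly P (1 + X ^ i1)) ↔ i1 ≤ (d + 1) / 2 := by
  constructor
  · rintro ⟨P, hP, htop, hdelta⟩
    rw [hasDeltaPoly_one_add_X_pow_iff hi1] at hdelta
    rcases Nat.lt_or_ge 1 i1 with hlt | hle
    · have hone : ehrhartCount P 1 = d + 1 := by
        rw [hdelta 1 le_rfl, if_neg (by omega), Nat.choose_symm_add, Nat.choose_one_right, add_zero]
      obtain ⟨v, hind, hv, rfl⟩ := exists_simplex_of_ehrhartCount_one hP htop hone
      have := two_mul_le_of_ehrhartCount_simplex hi1 hv hind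
        (fun n hn hni => by rw [hdelta n hn, if_neg (by omega), add_zero])
        (by rw [hdelta i1 hi1, if_pos le_rfl]; simp)
      omega
    · omega
  · intro h
    obtain ⟨e, rfl⟩ : ∃ e, d = e + 1 := ⟨d - 1, by omega⟩
    refine ⟨convexHull ℝ (Set.range (volTwoVertex e i1)),
      ⟨Finset.univ.image (volTwoVertex e i1), ?_, by simp⟩, ?_,
      hasDeltaPoly_volTwoVertex hi1 (by omega)⟩
    · simpa [Set.range_subset_iff] using volTwoVertex_mem_latticePts e i1
    · rw [affineSpan_convexHull,
        (affineIndependent_volTwoVertex e i1).affineSpan_eq_top_iff_card_eq_finrank_add_one]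
      simp
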